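/- arXiv:1412.6185 — 2 statements merged into one kernel-verified Lean document; each statement's English description precedes it below -/
import Mathlib

section
/- Let ν be a nonzero σ-finite Borel measure on ℝ^d such that the set C = {θ ∈ ℝ^d : ∫ exp(−⟨θ,σ⟩) dν(σ) < ∞} is open and nonempty, and such that the support of ν is not contained in any affine hyperplane of ℝ^d. Then for every θ ∈ C the integral ∫ σ·exp(−⟨θ,σ⟩) dν(σ) converges, and the gradient map F : C → ℝ^d defined by F(θ) = (∫ σ·exp(−⟨θ,σ⟩) dν(σ)) / (∫ exp(−⟨θ,σ⟩) dν(σ)) is a bijection from C onto the interior of the closed convex hull of the support of ν. -/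
open MeasureTheory
open scoped RealInnerProductSpace

/-- The support of a Borel measure on `ℝ^d`: the set of points all of whose open
neighborhoods have positive measure. -/
def measSupport {d : ℕ} (ν : Measure (EuclideanSpace ℝ (Fin d))) :
    Set (EuclideanSpace ℝ (Fin d)) :=
  {x | ∀ U : Set (EuclideanSpace ℝ (Fin d)), IsOpen U → x ∈ U → 0 < ν U}

open Filter Topology
open scoped ENNReal

section ExponentialFamily

lemma abs_le_exp_add_exp_neg (x : ℝ) : |x| ≤ Real.exp x + Real.exp (-x) := by
  have h₁ := Real.add_one_le_exp x
  have h₂ := Real.add_one_le_exp (-x)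
  have h₃ := Real.exp_pos x
  have h₄ := Real.exp_pos (-x)
  exact abs_le.2 ⟨by linarith, by linarith⟩

/-- Fatou's lemma as lower semicontinuity of a parametric integral. -/
lemma lowerSemicontinuous_lintegral {X α : Type*} [TopologicalSpace X] [FirstCountableTopology X]
    [MeasurableSpace α] {μ : Measure α} {f : X → α → ℝ≥0∞} (hmeas : ∀ x, Measurable (f x))
    (hcont : ∀ a, Continuous fun x => f x a) :
    LowerSemicontinuous fun x => ∫⁻ a, f x a ∂μ := by
  rw [lowerSemicontinuous_iff_le_liminf]
  intro x
  calc ∫⁻ a, f x a ∂μ = ∫⁻ a, liminf (fun y => f y a) (𝓝 x) ∂μ :=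
        lintegral_congr fun a => (((hcont a).tendsto x).liminf_eq).symm
    _ ≤ _ := lintegral_liminf_le hmeas

variable {E : Type*} [NormedAddCommGroup E] [InnerProductSpace ℝ E]

/-- A vector-valued function is integrable as soon as all its scalar components are. -/
lemma integrable_of_forall_inner [FiniteDimensional ℝ E] {α : Type*} [MeasurableSpace α]
    {μ : Measure α} {f : α → E}
    (h : ∀ v : E, Integrable (fun a => ⟪v, f a⟫) μ) : Integrable f μ := by
  have hsum : f = fun a => ∑ i, ⟪stdOrthonormalBasis ℝ E i, f a⟫ • stdOrthonormalBasis ℝ E i :=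
    funext fun a => ((stdOrthonormalBasis ℝ E).sum_repr' (f a)).symm
  rw [hsum]
  exact integrable_finsetSum _ fun i _ => (h _).smul_const _

/-- A set contained in no hyperplane has a convex hull with nonempty interior. -/
lemma interior_convexHull_nonempty_of_not_subset_hyperplane [FiniteDimensional ℝ E] {s : Set E}
    (hs : s.Nonempty)
    (h : ∀ (u : E) (c : ℝ), u ≠ 0 → ¬ s ⊆ {x | ⟪u, x⟫ = c}) :
    (interior (convexHull ℝ s)).Nonempty := by
  rw [interior_convexHull_nonempty_iff_affineSpan_eq_top]
  obtain ⟨p, hp⟩ := hs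
  rw [← AffineSubspace.direction_eq_top_iff_of_nonempty ⟨p, subset_affineSpan ℝ s hp⟩,
    ← Submodule.orthogonal_eq_bot_iff, Submodule.eq_bot_iff]
  intro u hu
  by_contra hne
  refine h u ⟪u, p⟫ hne fun x hx => ?_
  have := (Submodule.mem_orthogonal' _ u).1 hu (x - p)
    (AffineSubspace.vsub_mem_direction (subset_affineSpan ℝ s hx) (subset_affineSpan ℝ s hp))
  rwa [inner_sub_right, sub_eq_zero] at this

lemma exp_mul_inner_sub (θ m u σ : E) :
    Real.exp (-⟪θ, σ⟫) * ⟪u, σ - m⟫ =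
      ⟪u, Real.exp (-⟪θ, σ⟫) • σ⟫ - Real.exp (-⟪θ, σ⟫) * ⟪u, m⟫ := by
  rw [inner_sub_right, real_inner_smul_right]
  ring

variable [MeasurableSpace E] {ν : Measure E}

lemma integrable_exp_mul_inner_sub {θ : E} (m u : E)
    (h₀ : Integrable (fun σ => Real.exp (-⟪θ, σ⟫)) ν)
    (h₁ : Integrable (fun σ => Real.exp (-⟪θ, σ⟫) • σ) ν) :
    Integrable (fun σ => Real.exp (-⟪θ, σ⟫) * ⟪u, σ - m⟫) ν := by
  simp only [exp_mul_inner_sub]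
  exact (h₁.const_inner u).sub (h₀.mul_const _)

lemma integrable_exp_sub_iff {θ : E} (m : E) :
    Integrable (fun σ => Real.exp (-⟪θ, σ - m⟫)) ν ↔
      Integrable (fun σ => Real.exp (-⟪θ, σ⟫)) ν := by
  have h (σ : E) : Real.exp (-⟪θ, σ - m⟫) = Real.exp ⟪θ, m⟫ * Real.exp (-⟪θ, σ⟫) := by
    rw [← Real.exp_add, inner_sub_right]
    ring_nf
  simp only [h]
  exact integrable_const_mul_iff (Real.exp_pos _).ne'.isUnit _

/-- If `⟪u, ·⟫` is almost everywhere constant, the support lies in a hyperplane. -/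
lemma support_subset_of_ae_inner_sub_eq_zero {u m : E} (h : ∀ᵐ σ ∂ν, ⟪u, σ - m⟫ = 0) :
    ν.support ⊆ {x | ⟪u, x⟫ = ⟪u, m⟫} := by
  refine Measure.support_subset_of_isClosed (isClosed_eq (by fun_prop) (by fun_prop)) ?_
  filter_upwards [h] with σ hσ
  rwa [inner_sub_right, sub_eq_zero] at hσ

/-- Strict Gibbs inequality: the partition function, recentred at the mean for the parameter `θ`,
has its strict minimum at `θ`. -/
lemma integral_exp_lt_of_gibbs_mean {θ m u : E}
    (hu : ¬ ν.support ⊆ {x | ⟪u, x⟫ = ⟪u, m⟫})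
    (h₀ : Integrable (fun σ => Real.exp (-⟪θ, σ⟫)) ν)
    (h₁ : Integrable (fun σ => Real.exp (-⟪θ, σ⟫) • σ) ν)
    (h₂ : Integrable (fun σ => Real.exp (-⟪θ + u, σ⟫)) ν)
    (hm : ∫ σ, Real.exp (-⟪θ, σ⟫) * ⟪u, σ - m⟫ ∂ν = 0) :
    ∫ σ, Real.exp (-⟪θ, σ⟫) ∂ν < Real.exp ⟪u, m⟫ * ∫ σ, Real.exp (-⟪θ + u, σ⟫) ∂ν := by
  by_contra! hle
  have hi := integrable_exp_mul_inner_sub m u h₀ h₁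
  set f : E → ℝ := fun σ => Real.exp ⟪u, m⟫ * Real.exp (-⟪θ + u, σ⟫) - Real.exp (-⟪θ, σ⟫) +
    Real.exp (-⟪θ, σ⟫) * ⟪u, σ - m⟫ with hf
  have hfeq (σ : E) : f σ =
      Real.exp (-⟪θ, σ⟫) * (Real.exp (-⟪u, σ - m⟫) - (-⟪u, σ - m⟫ + 1)) := by
    have : Real.exp ⟪u, m⟫ * Real.exp (-⟪θ + u, σ⟫) =
        Real.exp (-⟪θ, σ⟫) * Real.exp (-⟪u, σ - m⟫) := by
      rw [← Real.exp_add, ← Real.exp_add, inner_add_left, inner_sub_right]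
      ring_nf
    simp only [hf, this]
    ring
  have hnonneg : 0 ≤ f := fun σ => by
    rw [hfeq]
    exact mul_nonneg (Real.exp_pos _).le (sub_nonneg.2 (Real.add_one_le_exp _))
  have hfi : Integrable f ν := ((h₂.const_mul _).sub h₀).add hi
  have hint : ∫ σ, f σ ∂ν = 0 := by
    refine le_antisymm ?_ (integral_nonneg hnonneg)
    have hsplit := integral_add ((h₂.const_mul (Real.exp ⟪u, m⟫)).sub h₀) hi
    simp only [Pi.sub_apply] at hsplit
    rw [hf, hsplit, integral_sub (h₂.const_mul _) h₀, integral_const_mul, hm]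
    linarith
  refine hu (support_subset_of_ae_inner_sub_eq_zero ?_)
  filter_upwards [(integral_eq_zero_iff_of_nonneg hnonneg hfi).1 hint] with σ hσ
  by_contra hne
  rw [hfeq] at hσ
  exact (mul_pos (Real.exp_pos _)
    (sub_pos.2 (Real.add_one_lt_exp (neg_ne_zero.2 hne)))).ne' hσ

variable [FiniteDimensional ℝ E]

lemma integral_exp_mul_inner_sub {θ : E} (m u : E)
    (h₀ : Integrable (fun σ => Real.exp (-⟪θ, σ⟫)) ν)
    (h₁ : Integrable (fun σ => Real.exp (-⟪θ, σ⟫) • σ) ν) :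
    ∫ σ, Real.exp (-⟪θ, σ⟫) * ⟪u, σ - m⟫ ∂ν =
      ⟪u, (∫ σ, Real.exp (-⟪θ, σ⟫) • σ ∂ν) - (∫ σ, Real.exp (-⟪θ, σ⟫) ∂ν) • m⟫ := by
  simp only [exp_mul_inner_sub]
  rw [integral_sub (h₁.const_inner u) (h₀.mul_const _), integral_inner h₁, integral_mul_const,
    inner_sub_right, real_inner_smul_right]

/-- The Gibbs mean `m` at `θ` is characterised by the vanishing of all centred moments. -/
lemma gibbs_mean_eq_iff [NeZero ν] {θ m : E}
    (h₀ : Integrable (fun σ => Real.exp (-⟪θ, σ⟫)) ν)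
    (h₁ : Integrable (fun σ => Real.exp (-⟪θ, σ⟫) • σ) ν) :
    (∫ σ, Real.exp (-⟪θ, σ⟫) ∂ν)⁻¹ • ∫ σ, Real.exp (-⟪θ, σ⟫) • σ ∂ν = m ↔
      ∀ u : E, ∫ σ, Real.exp (-⟪θ, σ⟫) * ⟪u, σ - m⟫ ∂ν = 0 := by
  have hZ := (integral_exp_pos h₀).ne'
  rw [inv_smul_eq_iff₀ hZ]
  simp only [integral_exp_mul_inner_sub m _ h₀ h₁]
  constructor
  · intro h u
    rw [h, sub_self, inner_zero_right]
  · intro h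
    exact sub_eq_zero.1 (inner_self_eq_zero (𝕜 := ℝ).1 (h _))

/-- The Gibbs mean lies in the interior of the closed convex hull of the support. -/
lemma gibbs_mean_mem_interior [NeZero ν]
    (hmin : ∀ (u : E) (c : ℝ), u ≠ 0 → ¬ ν.support ⊆ {x | ⟪u, x⟫ = c}) {θ m : E}
    (h₀ : Integrable (fun σ => Real.exp (-⟪θ, σ⟫)) ν)
    (h₁ : Integrable (fun σ => Real.exp (-⟪θ, σ⟫) • σ) ν)
    (hm : ∀ u : E, ∫ σ, Real.exp (-⟪θ, σ⟫) * ⟪u, σ - m⟫ ∂ν = 0) :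
    m ∈ interior (closure (convexHull ℝ ν.support)) := by
  have hne := interior_convexHull_nonempty_of_not_subset_hyperplane
    (Measure.nonempty_support (NeZero.ne ν)) hmin
  have hconv := convex_convexHull ℝ ν.support
  rw [hconv.interior_closure_eq_interior_of_nonempty_interior hne]
  by_contra hmem
  obtain ⟨f, hf⟩ := geometric_hahn_banach_open_point hconv.interior isOpen_interior hmem
  obtain ⟨u, rfl⟩ := (InnerProductSpace.toDual ℝ E).surjective f
  simp only [InnerProductSpace.toDual_apply_apply] at hf
  have hu : u ≠ 0 := by
    rintro rfl
    obtain ⟨a, ha⟩ := hne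
    simpa using hf a ha
  have hle : ∀ x ∈ ν.support, ⟪u, x - m⟫ ≤ 0 := by
    have hsub : closure (interior (convexHull ℝ ν.support)) ⊆ {x | ⟪u, x⟫ ≤ ⟪u, m⟫} :=
      closure_minimal (fun a ha => (hf a ha).le) (isClosed_le (by fun_prop) (by fun_prop))
    rw [hconv.closure_interior_eq_closure_of_nonempty_interior hne] at hsub
    intro x hx
    rw [inner_sub_right, sub_nonpos]
    exact hsub (subset_closure (subset_convexHull ℝ _ hx))
  refine hmin u ⟪u, m⟫ hu (support_subset_of_ae_inner_sub_eq_zero ?_)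
  have hi := integrable_exp_mul_inner_sub m (-u) h₀ h₁
  have hnonneg : 0 ≤ᵐ[ν] fun σ => Real.exp (-⟪θ, σ⟫) * ⟪-u, σ - m⟫ := by
    filter_upwards [Measure.support_mem_ae (μ := ν)] with σ hσ
    rw [inner_neg_left]
    exact mul_nonneg (Real.exp_pos _).le (neg_nonneg.2 (hle σ hσ))
  filter_upwards [(integral_eq_zero_iff_of_nonneg_ae hnonneg hi).1 (hm _)] with σ hσ
  simpa using hσ

variable [BorelSpace E]

lemma integrable_exp_mul_inner {θ : E}
    (h : ∀ᶠ θ' in 𝓝 θ, Integrable (fun σ => Real.exp (-⟪θ', σ⟫)) ν) (v : E) :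
    Integrable (fun σ => Real.exp (-⟪θ, σ⟫) * ⟪v, σ⟫) ν := by
  have hplus : Tendsto (fun t : ℝ => θ + t • v) (𝓝[>] 0) (𝓝 θ) :=
    ((by fun_prop : Continuous fun t : ℝ => θ + t • v).tendsto' 0 θ (by simp)).mono_left
      nhdsWithin_le_nhds
  have hminus : Tendsto (fun t : ℝ => θ - t • v) (𝓝[>] 0) (𝓝 θ) :=
    ((by fun_prop : Continuous fun t : ℝ => θ - t • v).tendsto' 0 θ (by simp)).mono_left
      nhdsWithin_le_nhds
  obtain ⟨t, ⟨h₁, h₂⟩, ht⟩ :=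
    (((hplus.eventually h).and (hminus.eventually h)).and self_mem_nhdsWithin).exists
  have ht : 0 < t := ht
  refine ((h₁.add h₂).const_mul t⁻¹).mono' (by fun_prop) (ae_of_all _ fun σ => ?_)
  have hb := mul_le_mul_of_nonneg_left (abs_le_exp_add_exp_neg (t * ⟪v, σ⟫))
    (Real.exp_pos (-⟪θ, σ⟫)).le
  rw [mul_add, ← Real.exp_add, ← Real.exp_add, abs_mul, abs_of_pos ht] at hb
  rw [Real.norm_eq_abs, abs_mul, Real.abs_exp, inv_mul_eq_div, le_div_iff₀ ht]
  simp only [Pi.add_apply, inner_add_left, inner_sub_left, real_inner_smul_left]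
  rw [show -(⟪θ, σ⟫ + t * ⟪v, σ⟫) = -⟪θ, σ⟫ + -(t * ⟪v, σ⟫) by ring,
    show -(⟪θ, σ⟫ - t * ⟪v, σ⟫) = -⟪θ, σ⟫ + t * ⟪v, σ⟫ by ring]
  linarith

lemma integrable_exp_smul {θ : E}
    (h : ∀ᶠ θ' in 𝓝 θ, Integrable (fun σ => Real.exp (-⟪θ', σ⟫)) ν) :
    Integrable (fun σ => Real.exp (-⟪θ, σ⟫) • σ) ν :=
  integrable_of_forall_inner fun v => by
    simpa only [real_inner_smul_right] using integrable_exp_mul_inner h v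

/-- The recentred partition function is coercive: it dominates a positive multiple of the norm. -/
lemma exists_pos_mul_norm_le_lintegral_exp {m : E}
    (hm : m ∈ interior (closure (convexHull ℝ ν.support))) :
    ∃ ε : ℝ≥0∞, ε ≠ 0 ∧ ∀ θ : E,
      ENNReal.ofReal ‖θ‖ * ε ≤ ∫⁻ σ, ENNReal.ofReal (Real.exp (-⟪θ, σ - m⟫)) ∂ν := by
  set H : E → ℝ≥0∞ := fun u => ∫⁻ σ, ENNReal.ofReal (-⟪u, σ - m⟫) ∂ν with hH
  have hlsc : LowerSemicontinuous H :=
    lowerSemicontinuous_lintegral (fun u => by fun_prop)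
      (fun σ => ENNReal.continuous_ofReal.comp (by fun_prop))
  have hpos : ∀ u : E, u ≠ 0 → H u ≠ 0 := by
    intro u hu h0
    have hae : ∀ᵐ σ ∂ν, 0 ≤ ⟪u, σ - m⟫ := by
      filter_upwards [(lintegral_eq_zero_iff (by fun_prop)).1 h0] with σ hσ
      simpa using hσ
    have hsupp : ν.support ⊆ {x | 0 ≤ ⟪u, x - m⟫} :=
      Measure.support_subset_of_isClosed (isClosed_le (by fun_prop) (by fun_prop)) hae
    have hhalf : Convex ℝ {x : E | 0 ≤ ⟪u, x - m⟫} := by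
      simp only [inner_sub_right, sub_nonneg]
      exact convex_halfSpace_ge (innerₛₗ ℝ u).isLinear _
    have hK : closure (convexHull ℝ ν.support) ⊆ {x | 0 ≤ ⟪u, x - m⟫} :=
      closure_minimal (convexHull_min hsupp hhalf) (isClosed_le (by fun_prop) (by fun_prop))
    have hlim : Tendsto (fun t : ℝ => m - t • u) (𝓝[>] 0) (𝓝 m) :=
      ((by fun_prop : Continuous fun t : ℝ => m - t • u).tendsto' 0 m (by simp)).mono_left
        nhdsWithin_le_nhds
    obtain ⟨t, ht, htpos⟩ :=
      ((hlim.eventually (mem_interior_iff_mem_nhds.1 hm)).and self_mem_nhdsWithin).exists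
    have hle : 0 ≤ ⟪u, m - t • u - m⟫ := hK ht
    have htpos : 0 < t := htpos
    rw [sub_sub_cancel_left, inner_neg_right, real_inner_smul_right,
      real_inner_self_eq_norm_sq] at hle
    have : 0 < t * ‖u‖ ^ 2 := mul_pos htpos (pow_pos (norm_pos_iff.2 hu) 2)
    linarith
  obtain ⟨ε, hε, hmin⟩ : ∃ ε : ℝ≥0∞, ε ≠ 0 ∧ ∀ u ∈ Metric.sphere (0 : E) 1, ε ≤ H u := by
    rcases (Metric.sphere (0 : E) 1).eq_empty_or_nonempty with he | hne
    · exact ⟨1, one_ne_zero, by simp [he]⟩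
    · obtain ⟨a, ha, hmin⟩ := (hlsc.lowerSemicontinuousOn _).exists_isMinOn hne
        (isCompact_sphere 0 1)
      exact ⟨H a, hpos a (ne_zero_of_mem_unit_sphere ⟨a, ha⟩), fun u hu => hmin hu⟩
  refine ⟨ε, hε, fun θ => ?_⟩
  rcases eq_or_ne θ 0 with rfl | hθ
  · simp
  calc ENNReal.ofReal ‖θ‖ * ε ≤ ENNReal.ofReal ‖θ‖ * H (‖θ‖⁻¹ • θ) := by
        gcongr
        exact hmin _ (by simp [norm_smul, hθ])
    _ = H θ := by
        rw [hH, ← lintegral_const_mul _ (by fun_prop)]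
        refine lintegral_congr fun σ => ?_
        rw [← ENNReal.ofReal_mul (norm_nonneg _), real_inner_smul_left, ← mul_neg,
          mul_inv_cancel_left₀ (norm_ne_zero_iff.2 hθ)]
    _ ≤ _ := lintegral_mono fun σ => ENNReal.ofReal_le_ofReal
        ((lt_add_one _).le.trans (Real.add_one_le_exp _))

lemma integrable_exp_sub_iff_lintegral_ne_top {θ m : E} :
    Integrable (fun σ => Real.exp (-⟪θ, σ - m⟫)) ν ↔
      ∫⁻ σ, ENNReal.ofReal (Real.exp (-⟪θ, σ - m⟫)) ∂ν ≠ ∞ :=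
  (lintegral_ofReal_ne_top_iff_integrable (by fun_prop)
    (ae_of_all _ fun _ => (Real.exp_pos _).le)).symm

/-- The recentred partition function attains its minimum at an integrable parameter. -/
lemma exists_isMin_lintegral_exp {m θ₀ : E}
    (hm : m ∈ interior (closure (convexHull ℝ ν.support)))
    (hθ₀ : Integrable (fun σ => Real.exp (-⟪θ₀, σ⟫)) ν) :
    ∃ θ : E, Integrable (fun σ => Real.exp (-⟪θ, σ⟫)) ν ∧
      ∀ θ' : E, ∫⁻ σ, ENNReal.ofReal (Real.exp (-⟪θ, σ - m⟫)) ∂ν ≤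
        ∫⁻ σ, ENNReal.ofReal (Real.exp (-⟪θ', σ - m⟫)) ∂ν := by
  set G : E → ℝ≥0∞ := fun θ => ∫⁻ σ, ENNReal.ofReal (Real.exp (-⟪θ, σ - m⟫)) ∂ν with hG
  have hlsc : LowerSemicontinuous G :=
    lowerSemicontinuous_lintegral (fun u => by fun_prop)
      (fun σ => ENNReal.continuous_ofReal.comp (by fun_prop))
  have hfin : G θ₀ ≠ ∞ :=
    integrable_exp_sub_iff_lintegral_ne_top.1 ((integrable_exp_sub_iff m).2 hθ₀)
  obtain ⟨ε, hε, hcoer⟩ := exists_pos_mul_norm_le_lintegral_exp hm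
  have hcompact : IsCompact {θ | G θ ≤ G θ₀} := by
    refine Metric.isCompact_of_isClosed_isBounded (hlsc.isClosed_preimage _) ?_
    refine isBounded_iff_forall_norm_le.2 ⟨(G θ₀ / ε).toReal, fun θ hθ => ?_⟩
    rw [← ENNReal.ofReal_le_iff_le_toReal (ENNReal.div_ne_top hfin hε)]
    exact ENNReal.le_div_iff_mul_le (.inl hε) (.inr hfin) |>.2 ((hcoer θ).trans hθ)
  obtain ⟨θ, hθ, hmin⟩ := (hlsc.lowerSemicontinuousOn _).exists_isMinOn
    ⟨θ₀, le_refl (G θ₀)⟩ hcompact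
  refine ⟨θ, (integrable_exp_sub_iff m).1 (integrable_exp_sub_iff_lintegral_ne_top.2
    (ne_top_of_le_ne_top hfin hθ)), fun θ' => ?_⟩
  rcases le_total (G θ') (G θ₀) with h | h
  · exact hmin h
  · exact le_trans hθ h

/-- Directional derivative of the recentred partition function. -/
lemma hasDerivAt_integral_exp_sub {θ : E} (m v : E)
    (h : ∀ᶠ θ' in 𝓝 θ, Integrable (fun σ => Real.exp (-⟪θ', σ⟫)) ν) :
    HasDerivAt (fun t : ℝ => ∫ σ, Real.exp (-⟪θ + t • v, σ - m⟫) ∂ν)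
      (∫ σ, Real.exp (-⟪θ, σ - m⟫) * -⟪v, σ - m⟫ ∂ν) 0 := by
  set w : E → NNReal := fun σ => (Real.exp (-⟪θ, σ - m⟫)).toNNReal with hw
  have hwm : Measurable w := by fun_prop
  have hwc (σ : E) : (w σ : ℝ) = Real.exp (-⟪θ, σ - m⟫) :=
    Real.coe_toNNReal _ (Real.exp_pos _).le
  have hexp (t : ℝ) (σ : E) : w σ • Real.exp (t * -⟪v, σ - m⟫) =
      Real.exp (-⟪θ + t • v, σ - m⟫) := by
    rw [NNReal.smul_def, hwc, smul_eq_mul, ← Real.exp_add, inner_add_left, real_inner_smul_left]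
    ring_nf
  have hset : (0 : ℝ) ∈ interior (ProbabilityTheory.integrableExpSet (fun σ => -⟪v, σ - m⟫)
      (ν.withDensity fun σ => w σ)) := by
    rw [mem_interior_iff_mem_nhds]
    have hlim : Tendsto (fun t : ℝ => θ + t • v) (𝓝 0) (𝓝 θ) :=
      (by fun_prop : Continuous fun t : ℝ => θ + t • v).tendsto' 0 θ (by simp)
    filter_upwards [hlim.eventually h] with t ht
    refine (integrable_withDensity_iff_integrable_smul hwm).2 ?_
    simp only [hexp]
    exact (integrable_exp_sub_iff m).2 ht
  have hderiv := ProbabilityTheory.hasDerivAt_mgf hset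
  rw [integral_withDensity_eq_integral_smul hwm] at hderiv
  convert hderiv using 1
  · funext t
    rw [ProbabilityTheory.mgf, integral_withDensity_eq_integral_smul hwm]
    simp only [hexp]
  · simp [NNReal.smul_def, hwc]

/-- Every interior point of the closed convex hull of the support is a Gibbs mean. -/
lemma exists_gibbs_mean_eq {m : E}
    (hopen : IsOpen {θ : E | Integrable (fun σ => Real.exp (-⟪θ, σ⟫)) ν})
    (hne : {θ : E | Integrable (fun σ => Real.exp (-⟪θ, σ⟫)) ν}.Nonempty)
    (hm : m ∈ interior (closure (convexHull ℝ ν.support))) :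
    ∃ θ : E, Integrable (fun σ => Real.exp (-⟪θ, σ⟫)) ν ∧
      ∀ u : E, ∫ σ, Real.exp (-⟪θ, σ⟫) * ⟪u, σ - m⟫ ∂ν = 0 := by
  obtain ⟨θ₀, hθ₀⟩ := hne
  obtain ⟨θ, hθ, hmin⟩ := exists_isMin_lintegral_exp hm hθ₀
  have hev : ∀ᶠ θ' in 𝓝 θ, Integrable (fun σ => Real.exp (-⟪θ', σ⟫)) ν := hopen.mem_nhds hθ
  refine ⟨θ, hθ, fun u => ?_⟩
  have hloc : IsLocalMin (fun t : ℝ => ∫ σ, Real.exp (-⟪θ + t • u, σ - m⟫) ∂ν) 0 := by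
    have hlim : Tendsto (fun t : ℝ => θ + t • u) (𝓝 0) (𝓝 θ) :=
      (by fun_prop : Continuous fun t : ℝ => θ + t • u).tendsto' 0 θ (by simp)
    filter_upwards [hlim.eventually hev] with t ht
    have hnonneg (θ' : E) : 0 ≤ᵐ[ν] fun σ => Real.exp (-⟪θ', σ - m⟫) :=
      ae_of_all _ fun _ => (Real.exp_pos _).le
    simp only [zero_smul, add_zero]
    rw [integral_eq_lintegral_of_nonneg_ae (hnonneg _) (by fun_prop),
      integral_eq_lintegral_of_nonneg_ae (hnonneg _) (by fun_prop)]
    exact ENNReal.toReal_mono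
      (integrable_exp_sub_iff_lintegral_ne_top.1 ((integrable_exp_sub_iff m).2 ht)) (hmin _)
  have hzero := hloc.hasDerivAt_eq_zero (hasDerivAt_integral_exp_sub m u hev)
  have hrw (σ : E) : Real.exp (-⟪θ, σ - m⟫) * -⟪u, σ - m⟫ =
      -Real.exp ⟪θ, m⟫ * (Real.exp (-⟪θ, σ⟫) * ⟪u, σ - m⟫) := by
    rw [inner_sub_right θ, show -(⟪θ, σ⟫ - ⟪θ, m⟫) = ⟪θ, m⟫ + -⟪θ, σ⟫ by ring, Real.exp_add]
    ring
  simp only [hrw, integral_const_mul] at hzero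
  exact (mul_eq_zero.1 hzero).resolve_left (neg_ne_zero.2 (Real.exp_pos _).ne')

end ExponentialFamily

/-- For a nonzero σ-finite Borel measure `ν` on `ℝ^d` whose canonical parameter set
`C = {θ : ∫ exp(-⟨θ,σ⟩) dν(σ) < ∞}` is open and nonempty (regularity) and whose support
is not contained in any affine hyperplane (minimality), for each `θ ∈ C` the integral
`∫ σ • exp(-⟨θ,σ⟩) dν(σ)` converges, and the gradient map
`F(θ) = (∫ σ • exp(-⟨θ,σ⟩) dν)/(∫ exp(-⟨θ,σ⟫) dν)` is a bijection from `C` onto the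
interior of the closed convex hull of the support of `ν`. -/
theorem stmt0 {d : ℕ} (ν : Measure (EuclideanSpace ℝ (Fin d))) [SigmaFinite ν]
    (hν : ν ≠ 0)
    (C : Set (EuclideanSpace ℝ (Fin d)))
    (hC : C = {θ | Integrable (fun σ => Real.exp (-⟪θ, σ⟫)) ν})
    (hCopen : IsOpen C) (hCne : C.Nonempty)
    (hmin : ∀ (u : EuclideanSpace ℝ (Fin d)) (c : ℝ), u ≠ 0 →
      ¬ (measSupport ν ⊆ {x | ⟪u, x⟫ = c}))
    (F : EuclideanSpace ℝ (Fin d) → EuclideanSpace ℝ (Fin d))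
    (hF : ∀ θ, F θ = (∫ σ, Real.exp (-⟪θ, σ⟫) ∂ν)⁻¹ •
      ∫ σ, Real.exp (-⟪θ, σ⟫) • σ ∂ν) :
    (∀ θ ∈ C, Integrable (fun σ => Real.exp (-⟪θ, σ⟫) • σ) ν) ∧
      Set.BijOn F C (interior (closure (convexHull ℝ (measSupport ν)))) := by
  subst hC
  have : NeZero ν := ⟨hν⟩
  have hsupp : measSupport ν = ν.support := by
    rw [Measure.support_eq_forall_isOpen]
    ext x
    exact forall_congr' fun U => forall_comm
  rw [hsupp] at hmin ⊢
  have hint : ∀ θ ∈ {θ | Integrable (fun σ => Real.exp (-⟪θ, σ⟫)) ν},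
      Integrable (fun σ => Real.exp (-⟪θ, σ⟫) • σ) ν :=
    fun θ hθ => integrable_exp_smul (hCopen.mem_nhds hθ)
  have hmean : ∀ θ ∈ {θ | Integrable (fun σ => Real.exp (-⟪θ, σ⟫)) ν}, ∀ m, F θ = m ↔
      ∀ u, ∫ σ, Real.exp (-⟪θ, σ⟫) * ⟪u, σ - m⟫ ∂ν = 0 := fun θ hθ m => by
    rw [hF, gibbs_mean_eq_iff hθ (hint θ hθ)]
  refine ⟨hint, fun θ hθ => ?_, fun θ hθ θ' hθ' heq => ?_, fun m hm => ?_⟩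
  · exact gibbs_mean_mem_interior hmin hθ (hint θ hθ) ((hmean θ hθ _).1 rfl)
  · by_contra hne
    have hlt := integral_exp_lt_of_gibbs_mean (hmin (θ' - θ) _ (sub_ne_zero.2 (Ne.symm hne))) hθ
      (hint θ hθ) (by rwa [add_sub_cancel]) ((hmean θ hθ _).1 rfl _)
    have hlt' := integral_exp_lt_of_gibbs_mean (hmin (θ - θ') _ (sub_ne_zero.2 hne)) hθ'
      (hint θ' hθ') (by rwa [add_sub_cancel]) ((hmean θ' hθ' _).1 heq.symm _)
    rw [add_sub_cancel] at hlt hlt'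
    rw [← neg_sub θ' θ, inner_neg_left] at hlt'
    have hmul := mul_lt_mul_of_pos_left hlt' (Real.exp_pos ⟪θ' - θ, F θ⟫)
    rw [← mul_assoc, ← Real.exp_add, add_neg_cancel, Real.exp_zero, one_mul] at hmul
    exact lt_asymm hlt hmul
  · obtain ⟨θ, hθ, hzero⟩ := exists_gibbs_mean_eq hCopen hCne hm
    exact ⟨θ, hθ, (hmean θ hθ m).2 hzero⟩
end

section
/- Let f be a nonconstant homogeneous polynomial in ℝ[θ₁,…,θ_d], let C ⊆ ℝ^d be a nonempty open convex cone on which f is strictly positive, and let α > 0 be a real number. Suppose there exists a Borel measure ν on ℝ^d such that f(θ)^{−α} = ∫ exp(−⟨θ,σ⟩) dν(σ) for all θ ∈ C. Then f is hyperbolic with respect to every point τ ∈ C; that is, for every τ ∈ C, every v ∈ ℝ^d and every complex number z, if f(v + z·τ) = 0 (evaluating the complexification of f at the complex point v + z·τ) then z is real. -/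
open MeasureTheory

open Filter Topology in
/-- If `a * g' * G + g * G' = 0` near `s` with `a > 0` and neither `g` nor `G` vanishes identically
near `s`, then comparing leading coefficients shows that `g` does not vanish at `s`. -/
lemma ne_zero_of_eventually_mul_deriv_mul_add_mul_deriv_eq_zero {g G : ℂ → ℂ} {s : ℂ} {a : ℝ}
    (ha : 0 < a) (hg : AnalyticAt ℂ g s) (hG : AnalyticAt ℂ G s)
    (hg0 : ¬ ∀ᶠ z in 𝓝 s, g z = 0) (hG0 : ¬ ∀ᶠ z in 𝓝 s, G z = 0)
    (hrel : ∀ᶠ z in 𝓝 s, a * deriv g z * G z + g z * deriv G z = 0) : g s ≠ 0 := by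
  intro hgs
  obtain ⟨m, h, hh, hhs, hgh⟩ := hg.exists_eventuallyEq_pow_smul_nonzero_iff.2 hg0
  obtain ⟨k, H, hH, hHs, hGH⟩ := hG.exists_eventuallyEq_pow_smul_nonzero_iff.2 hG0
  have hm : m ≠ 0 := by
    rintro rfl
    have := hgh.self_of_nhds
    simp [hgs, eq_comm, hhs] at this
  have deriv_pow_mul : ∀ (n : ℕ) (F u : ℂ → ℂ), AnalyticAt ℂ u s →
      (∀ᶠ z in 𝓝 s, F z = (z - s) ^ n • u z) →
      ∀ᶠ z in 𝓝 s, (z - s) * deriv F z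
        = (z - s) ^ n * (n * u z + (z - s) * deriv u z) := by
    intro n F u hu hF
    filter_upwards [hF.eventually_nhds, hu.eventually_analyticAt] with z hFz huz
    have hd : HasDerivAt (fun y : ℂ => (y - s) ^ n * u y)
        (n * (z - s) ^ (n - 1) * 1 * u z + (z - s) ^ n * deriv u z) z :=
      (((hasDerivAt_id z).sub_const s).pow n).mul huz.differentiableAt.hasDerivAt
    rw [EventuallyEq.deriv_eq (f := fun y : ℂ => (y - s) ^ n * u y) hFz, hd.deriv]
    rcases n with _ | n
    · simp
    · rw [Nat.add_sub_cancel, pow_succ]; ring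
  let Q : ℂ → ℂ := fun z =>
    a * (m * h z + (z - s) * deriv h z) * H z + h z * (k * H z + (z - s) * deriv H z)
  have hQ : ContinuousAt Q s := by
    have := hh.continuousAt
    have := hH.continuousAt
    have := hh.deriv.continuousAt
    have := hH.deriv.continuousAt
    fun_prop
  have hQ0 : ∀ᶠ z in 𝓝[≠] s, Q z = 0 := by
    filter_upwards [nhdsWithin_le_nhds hrel, nhdsWithin_le_nhds hgh, nhdsWithin_le_nhds hGH,
      nhdsWithin_le_nhds (deriv_pow_mul m g h hh hgh),
      nhdsWithin_le_nhds (deriv_pow_mul k G H hH hGH), self_mem_nhdsWithin]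
      with z h1 h2 h3 h4 h5 hz
    have hz' : (z - s) ^ (m + k) ≠ 0 := pow_ne_zero _ (sub_ne_zero.2 hz)
    refine (mul_eq_zero.1 ?_).resolve_left hz'
    simp only [smul_eq_mul] at h2 h3
    calc (z - s) ^ (m + k) * Q z
        = a * ((z - s) ^ m * (m * h z + (z - s) * deriv h z)) * ((z - s) ^ k * H z)
          + ((z - s) ^ m * h z) * ((z - s) ^ k * (k * H z + (z - s) * deriv H z)) := by
          simp only [Q]; ring
      _ = (z - s) * (a * deriv g z * G z + g z * deriv G z) := by
          rw [← h4, ← h5, ← h2, ← h3]; ring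
      _ = 0 := by rw [h1, mul_zero]
  have hQs : Q s = 0 := tendsto_nhds_unique (hQ.tendsto.mono_left nhdsWithin_le_nhds)
    (tendsto_const_nhds.congr' (hQ0.mono fun _ hz => hz.symm))
  have hfac : ((a * m + k : ℝ) : ℂ) * (h s * H s) = 0 := by
    rw [← hQs]; simp only [Q]; push_cast; ring
  have hpos : (0 : ℝ) < a * m + k := by
    have : (0 : ℝ) < m := by exact_mod_cast Nat.pos_of_ne_zero hm
    positivity
  exact mul_ne_zero (by exact_mod_cast hpos.ne') (mul_ne_zero hhs hHs) hfac

open Filter Topology in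
/-- Let `g` and `G` be holomorphic on a preconnected open set containing a real point `x₀`. If near
`x₀` on the real line `g` agrees with a positive differentiable function `γ` and `G` with `γ ^ (-a)`
for some `a > 0`, then `g` has no zero. -/
lemma ne_zero_of_eventually_eq_rpow_neg {g G : ℂ → ℂ} {U : Set ℂ} {a : ℝ} (ha : 0 < a)
    (hUo : IsOpen U) (hU : IsPreconnected U) (hg : AnalyticOnNhd ℂ g U) (hG : AnalyticOnNhd ℂ G U)
    {x₀ : ℝ} (hx₀ : (x₀ : ℂ) ∈ U) {γ : ℝ → ℝ} (hγ : Differentiable ℝ γ)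
    (hpos : ∀ᶠ x in 𝓝 x₀, 0 < γ x) (hgγ : ∀ᶠ x : ℝ in 𝓝 x₀, g x = γ x)
    (hGγ : ∀ᶠ x : ℝ in 𝓝 x₀, G x = (γ x ^ (-a) : ℝ)) {s : ℂ} (hs : s ∈ U) : g s ≠ 0 := by
  have not_eventually_zero : ∀ F : ℂ → ℂ, AnalyticOnNhd ℂ F U → F x₀ ≠ 0 →
      ¬ ∀ᶠ z in 𝓝 s, F z = 0 := fun F hF hF0 h =>
    hF0 (hF.eqOn_zero_of_preconnected_of_eventuallyEq_zero hU hs h hx₀)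
  have hpos₀ := hpos.self_of_nhds
  have hrel : Set.EqOn (fun z => a * deriv g z * G z + g z * deriv G z) 0 U := by
    refine AnalyticOnNhd.eqOn_zero_of_preconnected_of_frequently_eq_zero
      (((analyticOnNhd_const.mul hg.deriv).mul hG).add (hg.mul hG.deriv)) hU hx₀ ?_
    have hreal : ∀ᶠ x : ℝ in 𝓝 x₀, a * deriv g x * G x + g x * deriv G x = 0 := by
      filter_upwards [hpos, hgγ.eventually_nhds, hGγ.eventually_nhds,
        Complex.continuous_ofReal.continuousAt.eventually (hUo.mem_nhds hx₀)] with x hx h1 h2 hxU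
      have d1 := (hγ x).hasDerivAt
      have e1 : deriv g x = (deriv γ x : ℝ) :=
        ((hg x hxU).differentiableAt.hasDerivAt.comp_ofReal.congr_of_eventuallyEq
          (h1.mono fun _ h => h.symm)).unique d1.ofReal_comp
      have e2 : deriv G x = (deriv γ x * (-a) * γ x ^ (-a - 1) : ℝ) :=
        ((hG x hxU).differentiableAt.hasDerivAt.comp_ofReal.congr_of_eventuallyEq
          (h2.mono fun _ h => h.symm)).unique (d1.rpow_const (Or.inl hx.ne')).ofReal_comp
      rw [e1, e2, h1.self_of_nhds, h2.self_of_nhds, Real.rpow_sub_one hx.ne']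
      norm_cast
      field_simp
      ring
    have htend : Tendsto (fun x : ℝ => (x : ℂ)) (𝓝[≠] x₀) (𝓝[≠] (x₀ : ℂ)) :=
      tendsto_nhdsWithin_iff.2 ⟨Complex.continuous_ofReal.continuousAt.tendsto.mono_left
        nhdsWithin_le_nhds, eventually_nhdsWithin_of_forall fun x hx => by simpa using hx⟩
    exact htend.frequently (hreal.filter_mono nhdsWithin_le_nhds).frequently
  refine ne_zero_of_eventually_mul_deriv_mul_add_mul_deriv_eq_zero ha (hg s hs) (hG s hs)
    (not_eventually_zero g hg ?_) (not_eventually_zero G hG ?_)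
    ((hUo.eventually_mem hs).mono fun z hz => hrel hz)
  · rw [hgγ.self_of_nhds]
    exact_mod_cast hpos₀.ne'
  · rw [hGγ.self_of_nhds]
    exact_mod_cast (Real.rpow_pos_of_pos hpos₀ _).ne'

/-- A homogeneous polynomial of degree `p` scales by `c ^ p` when its argument is scaled by `c`. -/
lemma MvPolynomial.IsHomogeneous.eval_const_mul {σ R : Type*} [CommSemiring R]
    {f : MvPolynomial σ R} {p : ℕ} (hf : f.IsHomogeneous p) (c : R) (x : σ → R) :
    MvPolynomial.eval (fun i => c * x i) f = c ^ p * MvPolynomial.eval x f := by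
  rw [MvPolynomial.eval_eq, MvPolynomial.eval_eq, Finset.mul_sum]
  refine Finset.sum_congr rfl fun m hm => ?_
  have hdeg : ∑ i ∈ m.support, m i = p := by
    rw [← hf (MvPolynomial.mem_support_iff.1 hm), Finsupp.weight_apply, Finsupp.sum]
    simp
  simp_rw [mul_pow]
  rw [Finset.prod_mul_distrib, Finset.prod_pow_eq_pow_sum, hdeg]
  ring

open Filter Topology ProbabilityTheory in
/-- If `f ^ (-α)` is a Laplace transform on an open set `C`, then `f` has no zero in the tube
`C + iℝ^d`. -/
lemma eval_add_I_mul_ne_zero_of_rpow_neg_eq_laplace {d : ℕ} (f : MvPolynomial (Fin d) ℝ)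
    {C : Set (Fin d → ℝ)} (hCopen : IsOpen C) (hpos : ∀ θ ∈ C, 0 < MvPolynomial.eval θ f)
    {α : ℝ} (hα : 0 < α) (ν : Measure (Fin d → ℝ))
    (hrep : ∀ θ ∈ C, (MvPolynomial.eval θ f) ^ (-α) =
      ∫ σ, Real.exp (-(∑ i, θ i * σ i)) ∂ν)
    {τ : Fin d → ℝ} (hτ : τ ∈ C) (w : Fin d → ℝ) :
    MvPolynomial.eval (fun i => (τ i : ℂ) + Complex.I * w i)
      (MvPolynomial.map (algebraMap ℝ ℂ) f) ≠ 0 := by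
  have hint : ∀ θ ∈ C, Integrable (fun σ : Fin d → ℝ => Real.exp (-(∑ i, θ i * σ i))) ν := by
    intro θ hθ
    by_contra h
    have := hrep θ hθ
    rw [integral_undef h] at this
    exact (Real.rpow_pos_of_pos (hpos θ hθ) _).ne' this
  have hline : ∀ᶠ x : ℝ in 𝓝 0, (fun i => τ i + x * w i) ∈ C := by
    have hc : Continuous fun x : ℝ => (fun i => τ i + x * w i) := by fun_prop
    exact hc.continuousAt.eventually (hCopen.mem_nhds (by simpa using hτ))
  -- tilting `ν` turns the Laplace transform along the line into a moment generating function
  let ρ : (Fin d → ℝ) → NNReal := fun σ => (Real.exp (-(∑ i, τ i * σ i))).toNNReal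
  have hρ : Measurable ρ := by fun_prop
  let μ : Measure (Fin d → ℝ) := ν.withDensity fun σ => ρ σ
  let X : (Fin d → ℝ) → ℝ := fun σ => -(∑ i, w i * σ i)
  have htilt : ∀ (x : ℝ) (σ : Fin d → ℝ),
      ρ σ • Real.exp (x * X σ) = Real.exp (-(∑ i, (τ i + x * w i) * σ i)) := by
    intro x σ
    rw [NNReal.smul_def, smul_eq_mul, Real.coe_toNNReal _ (Real.exp_nonneg _), ← Real.exp_add]
    simp only [X, add_mul, Finset.sum_add_distrib, mul_assoc, ← Finset.mul_sum]
    ring_nf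
  have hmem : (0 : ℝ) ∈ interior (integrableExpSet X μ) := by
    refine mem_interior_iff_mem_nhds.2 (hline.mono fun x hx => ?_)
    refine (integrable_withDensity_iff_integrable_smul hρ).2 ?_
    simpa only [htilt] using hint _ hx
  have hG : ∀ᶠ x : ℝ in 𝓝 0, complexMGF X μ x
      = ((MvPolynomial.eval (fun i => τ i + x * w i) f) ^ (-α) : ℝ) := by
    filter_upwards [hline] with x hx
    rw [complexMGF_ofReal, hrep _ hx, mgf, integral_withDensity_eq_integral_smul hρ]
    simp only [htilt]
  have hreal : ∀ x : ℝ, MvPolynomial.eval (fun i => (τ i : ℂ) + x * w i)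
      (MvPolynomial.map (algebraMap ℝ ℂ) f)
      = (MvPolynomial.eval (fun i => τ i + x * w i) f : ℝ) := by
    intro x
    rw [MvPolynomial.eval_map]
    have := MvPolynomial.eval₂_comp_left (algebraMap ℝ ℂ) (RingHom.id ℝ)
      (fun i => τ i + x * w i) f
    simpa [MvPolynomial.eval₂_id, Function.comp_def] using this.symm
  refine ne_zero_of_eventually_eq_rpow_neg (x₀ := 0) (s := Complex.I)
    (g := fun z => MvPolynomial.eval (fun i => (τ i : ℂ) + z * w i)
      (MvPolynomial.map (algebraMap ℝ ℂ) f))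
    (γ := fun x : ℝ => MvPolynomial.eval (fun i => τ i + x * w i) f) hα
    (isOpen_interior.preimage Complex.continuous_re)
    (convex_integrableExpSet.interior.linear_preimage Complex.reLm).isPreconnected
    (fun z _ => ?_) analyticOnNhd_complexMGF (by simpa using hmem)
    (fun x => AnalyticAt.differentiableAt ?_) (hline.mono fun x hx => hpos _ hx)
    (.of_forall hreal) hG (by simpa using hmem)
  · exact AnalyticAt.aeval_mvPolynomial (fun i => by fun_prop) _
  · exact AnalyticAt.aeval_mvPolynomial (fun i => by fun_prop) _

/-- If a nonconstant homogeneous polynomial `f ∈ ℝ[θ₁,…,θ_d]`, strictly positive on a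
nonempty open convex cone `C`, satisfies `f(θ)^{-α} = ∫ exp(-⟨θ,σ⟩) dν(σ)` on `C` for
some `α > 0` and some Borel measure `ν`, then `f` is hyperbolic with respect to every
point `τ ∈ C`: for all `v ∈ ℝ^d`, every complex root `z` of `z ↦ f(v + z·τ)` is real. -/
theorem stmt1 {d p : ℕ} (f : MvPolynomial (Fin d) ℝ)
    (hp : 0 < p) (hf : f.IsHomogeneous p) (hf0 : f ≠ 0)
    (C : Set (Fin d → ℝ)) (hCne : C.Nonempty) (hCopen : IsOpen C)
    (hCconv : Convex ℝ C) (hCcone : ∀ θ ∈ C, ∀ t : ℝ, 0 < t → t • θ ∈ C)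
    (hpos : ∀ θ ∈ C, 0 < MvPolynomial.eval θ f)
    (α : ℝ) (hα : 0 < α) (ν : Measure (Fin d → ℝ))
    (hrep : ∀ θ ∈ C, (MvPolynomial.eval θ f) ^ (-α) =
      ∫ σ, Real.exp (-(∑ i, θ i * σ i)) ∂ν) :
    ∀ τ ∈ C, ∀ v : Fin d → ℝ, ∀ z : ℂ,
      MvPolynomial.eval (fun i => (v i : ℂ) + z * (τ i : ℂ))
        (MvPolynomial.map (algebraMap ℝ ℂ) f) = 0 → z.im = 0 := by
  intro τ hτ v z hz
  by_contra hb
  have hb' : (z.im : ℂ) ≠ 0 := by exact_mod_cast hb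
  let w : Fin d → ℝ := fun i => -(v i + z.re * τ i) / z.im
  refine eval_add_I_mul_ne_zero_of_rpow_neg_eq_laplace f hCopen hpos hα ν hrep hτ w ?_
  have hscale : (fun i => (v i : ℂ) + z * τ i)
      = fun i => (Complex.I * z.im) * ((τ i : ℂ) + Complex.I * w i) := by
    funext i
    have hw : (z.im : ℂ) * w i = -(v i + z.re * τ i) := by
      simp only [w]; push_cast; field_simp
    linear_combination (τ i : ℂ) * (Complex.re_add_im z).symm
      - (w i : ℂ) * z.im * Complex.I_sq + hw
  rw [hscale, (hf.map _).eval_const_mul] at hz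
  exact (mul_eq_zero.1 hz).resolve_left (pow_ne_zero _ (mul_ne_zero Complex.I_ne_zero hb'))
end
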